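/- A vector space decomposition: for a parabolically induced gl_{m+l}-module V ⊠ U = U(q) ⊗ V ⊗ U (where q is the nilradical opposite to the parabolic p = gl_m ⊕ gl_l ⊕ q'), the space of q-coinvariants of W = (V ⊠ U) ⊗ G(C^{m+l} ⊗ C^n) is, as a module over gl_m ⊕ gl_l, isomorphic to V ⊗ U ⊗ G(C^{m+l} ⊗ C^n) via the map y ⊗ x ⊗ f ↦ [1 ⊗ y ⊗ x ⊗ f]. In particular this map is a linear bijection. -/

import Mathlib

open scoped TensorProduct

noncomputable section

/- Setting for STATEMENT 16.  The decomposition `ℂ^{m+l} = ℂ^m ⊕ ℂ^l`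
embeds `gl_m ⊕ gl_l` into `gl_{m+l}`; the abelian nilradical `q` opposite to
the parabolic `p = gl_m ⊕ gl_l ⊕ q'` has basis `E_{m+d, a}` (`a ∈ Fin m`,
`d ∈ Fin l`).  Since `q` is abelian, `U(q)` is the polynomial algebra
`MvPolynomial (Fin m × Fin l) ℂ`.  The Grassmann algebra
`G(ℂ^{m+l} ⊗ ℂ^n)` is modelled by a module `G` equipped with Clifford
operators `xop r k` (left multiplications) and `dop r k` (left derivations);
the matrix unit `E_{r c} ∈ gl_{m+l}` acts on `G` as
`Σ_k xop r k * dop c k`.  A `gl_m`-module `V` and a `gl_l`-module `U` are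
given by `ρV`, `ρU`.  The parabolically induced module is
`V ⊠ U = U(q) ⊗ V ⊗ U`, on which `q` acts by left multiplication on the
first factor, and `W = (V ⊠ U) ⊗ G` carries the diagonal action. -/

/-- `U(q)`, the polynomial algebra on the basis `E_{m+d,a}` of `q`. -/
abbrev UQ (m l : ℕ) := MvPolynomial (Fin m × Fin l) ℂ

variable {V U G : Type*}
  [AddCommGroup V] [Module ℂ V] [AddCommGroup U] [Module ℂ U]
  [AddCommGroup G] [Module ℂ G]

/-- Action of the matrix unit `E_{r c} ∈ gl_{m+l}` on the Grassmann module. -/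
def gEop (m l n : ℕ) (xop dop : Fin (m + l) → Fin n → Module.End ℂ G)
    (r c : Fin (m + l)) : Module.End ℂ G :=
  ∑ k : Fin n, xop r k * dop c k

/-- The vector space of `W = (V ⊠ U) ⊗ G(ℂ^{m+l} ⊗ ℂ^n)`. -/
abbrev Wmod (m l : ℕ) (V U G : Type*) [AddCommGroup V] [Module ℂ V]
    [AddCommGroup U] [Module ℂ U] [AddCommGroup G] [Module ℂ G] :=
  UQ m l ⊗[ℂ] (V ⊗[ℂ] (U ⊗[ℂ] G))

/-- Lift of an operator on `G` to `V ⊗ U ⊗ G`. -/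
def thirdMap (f : Module.End ℂ G) :
    (V ⊗[ℂ] (U ⊗[ℂ] G)) →ₗ[ℂ] (V ⊗[ℂ] (U ⊗[ℂ] G)) :=
  TensorProduct.map LinearMap.id (TensorProduct.map LinearMap.id f)

/-- The action of the basis element `E_{m+d,a}` of `q ⊂ gl_{m+l}` on `W`:
left multiplication on the `U(q)`-factor plus the Grassmann part. -/
def qAct (m l n : ℕ) (xop dop : Fin (m + l) → Fin n → Module.End ℂ G)
    (a : Fin m) (d : Fin l) :
    Wmod m l V U G →ₗ[ℂ] Wmod m l V U G :=
  TensorProduct.map (LinearMap.mulLeft ℂ (MvPolynomial.X (a, d))) LinearMap.id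
    + TensorProduct.map LinearMap.id
        (thirdMap (gEop m l n xop dop (Fin.natAdd m d) (Fin.castAdd l a)))

/-- The adjoint action of `E_{ab} ∈ gl_m` on `U(q)`:
the derivation sending `X(c,d) = E_{m+d,c}` to `-δ_{ac} X(b,d)`. -/
def DmDer (m l : ℕ) (a b : Fin m) : UQ m l →ₗ[ℂ] UQ m l :=
  (MvPolynomial.mkDerivation ℂ fun p : Fin m × Fin l =>
    if p.1 = a then -(MvPolynomial.X (b, p.2) : UQ m l) else 0).toLinearMap

/-- The adjoint action of `E_{m+c,m+d} ∈ gl_l` on `U(q)`: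
the derivation sending `X(a,e) = E_{m+e,a}` to `δ_{ed} X(a,c)`. -/
def DlDer (m l : ℕ) (c d : Fin l) : UQ m l →ₗ[ℂ] UQ m l :=
  (MvPolynomial.mkDerivation ℂ fun p : Fin m × Fin l =>
    if p.2 = d then (MvPolynomial.X (p.1, c) : UQ m l) else 0).toLinearMap

/-- The action of `E_{ab} ∈ gl_m ⊂ gl_{m+l}` on `W`. -/
def glmW (m l n : ℕ) (ρV : Fin m → Fin m → Module.End ℂ V)
    (xop dop : Fin (m + l) → Fin n → Module.End ℂ G) (a b : Fin m) :
    Wmod m l V U G →ₗ[ℂ] Wmod m l V U G :=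
  TensorProduct.map (DmDer m l a b) LinearMap.id
    + TensorProduct.map LinearMap.id (TensorProduct.map (ρV a b) LinearMap.id)
    + TensorProduct.map LinearMap.id
        (thirdMap (gEop m l n xop dop (Fin.castAdd l a) (Fin.castAdd l b)))

/-- The action of `E_{m+c,m+d} ∈ gl_l ⊂ gl_{m+l}` on `W`. -/
def gllW (m l n : ℕ) (ρU : Fin l → Fin l → Module.End ℂ U)
    (xop dop : Fin (m + l) → Fin n → Module.End ℂ G) (c d : Fin l) :
    Wmod m l V U G →ₗ[ℂ] Wmod m l V U G :=
  TensorProduct.map (DlDer m l c d) LinearMap.id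
    + TensorProduct.map LinearMap.id
        (TensorProduct.map LinearMap.id (TensorProduct.map (ρU c d) LinearMap.id))
    + TensorProduct.map LinearMap.id
        (thirdMap (gEop m l n xop dop (Fin.natAdd m c) (Fin.natAdd m d)))

/-- The action of `E_{ab} ∈ gl_m` on `V ⊗ U ⊗ G`. -/
def glmVUG (m l n : ℕ) (ρV : Fin m → Fin m → Module.End ℂ V)
    (xop dop : Fin (m + l) → Fin n → Module.End ℂ G) (a b : Fin m) :
    (V ⊗[ℂ] (U ⊗[ℂ] G)) →ₗ[ℂ] (V ⊗[ℂ] (U ⊗[ℂ] G)) :=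
  TensorProduct.map (ρV a b) LinearMap.id
    + thirdMap (gEop m l n xop dop (Fin.castAdd l a) (Fin.castAdd l b))

/-- The action of `E_{m+c,m+d} ∈ gl_l` on `V ⊗ U ⊗ G`. -/
def gllVUG (m l n : ℕ) (ρU : Fin l → Fin l → Module.End ℂ U)
    (xop dop : Fin (m + l) → Fin n → Module.End ℂ G) (c d : Fin l) :
    (V ⊗[ℂ] (U ⊗[ℂ] G)) →ₗ[ℂ] (V ⊗[ℂ] (U ⊗[ℂ] G)) :=
  TensorProduct.map LinearMap.id (TensorProduct.map (ρU c d) LinearMap.id)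
    + thirdMap (gEop m l n xop dop (Fin.natAdd m c) (Fin.natAdd m d))

/-- The submodule `q·W` of `W`. -/
def qW (m l n : ℕ) (V U G : Type*) [AddCommGroup V] [Module ℂ V]
    [AddCommGroup U] [Module ℂ U] [AddCommGroup G] [Module ℂ G]
    (xop dop : Fin (m + l) → Fin n → Module.End ℂ G) :
    Submodule ℂ (Wmod m l V U G) :=
  ⨆ p : Fin m × Fin l, LinearMap.range (qAct m l n xop dop p.1 p.2)

/-- The map `y ⊗ x ⊗ f ↦ 1 ⊗ y ⊗ x ⊗ f : V ⊗ U ⊗ G → W`. -/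
def iota (m l : ℕ) : (V ⊗[ℂ] (U ⊗[ℂ] G)) →ₗ[ℂ] Wmod m l V U G :=
  TensorProduct.mk ℂ (UQ m l) (V ⊗[ℂ] (U ⊗[ℂ] G)) 1

section Helpers

theorem gEop_comm {G : Type*} [AddCommGroup G] [Module ℂ G] (m l n : ℕ)
    (xop dop : Fin (m + l) → Fin n → Module.End ℂ G)
    (hxx : ∀ (r c : Fin (m + l)) (k k' : Fin n),
      xop r k * xop c k' = -(xop c k' * xop r k))
    (hdd : ∀ (r c : Fin (m + l)) (k k' : Fin n),
      dop r k * dop c k' = -(dop c k' * dop r k))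
    (hxd : ∀ (r c : Fin (m + l)) (k k' : Fin n),
      xop r k * dop c k' + dop c k' * xop r k
        = if r = c ∧ k = k' then 1 else 0) (r c s t : Fin (m + l)) :
    gEop m l n xop dop r c * gEop m l n xop dop s t
      = gEop m l n xop dop s t * gEop m l n xop dop r c
        + ((if s = c then gEop m l n xop dop r t else 0)
          - (if r = t then gEop m l n xop dop s c else 0)) := by
  have key : ∀ k k' : Fin n,
      xop r k * dop c k * (xop s k' * dop t k')
        = xop s k' * dop t k' * (xop r k * dop c k)
          + ((if s = c ∧ k' = k then xop r k * dop t k' else 0)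
          - (if r = t ∧ k = k' then xop s k' * dop c k else 0)) := by
    intro k k'
    have h1 : dop c k * xop s k' = (if s = c ∧ k' = k then 1 else 0) - xop s k' * dop c k :=
      eq_sub_of_add_eq' (hxd s c k' k)
    have h2 : dop t k' * xop r k = (if r = t ∧ k = k' then 1 else 0) - xop r k * dop t k' :=
      eq_sub_of_add_eq' (hxd r t k k')
    have e1 : xop r k * dop c k * (xop s k' * dop t k')
        = (if s = c ∧ k' = k then xop r k * dop t k' else 0)
          - xop s k' * xop r k * (dop t k' * dop c k) := by
      calc _ = xop r k * (dop c k * xop s k') * dop t k' := by simp only [mul_assoc]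
        _ = xop r k * (if s = c ∧ k' = k then 1 else 0) * dop t k'
            - (xop r k * xop s k') * (dop c k * dop t k') := by
              rw [h1]; simp only [mul_sub, sub_mul, mul_assoc]
        _ = _ := by
              rw [hxx r s k k', hdd c t k k', neg_mul_neg]
              split_ifs <;> simp
    have e2 : xop s k' * dop t k' * (xop r k * dop c k)
        = (if r = t ∧ k = k' then xop s k' * dop c k else 0)
          - xop s k' * xop r k * (dop t k' * dop c k) := by
      calc _ = xop s k' * (dop t k' * xop r k) * dop c k := by simp only [mul_assoc]
        _ = xop s k' * (if r = t ∧ k = k' then 1 else 0) * dop c k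
            - xop s k' * xop r k * (dop t k' * dop c k) := by
              rw [h2]; simp only [mul_sub, sub_mul, mul_assoc]
        _ = _ := by split_ifs <;> simp
    rw [e1, e2]; abel
  have hs1 : (∑ k : Fin n, ∑ k' : Fin n,
      (if s = c ∧ k' = k then xop r k * dop t k' else 0))
      = if s = c then gEop m l n xop dop r t else 0 := by
    by_cases h : s = c <;> simp [h, gEop]
  have hs2 : (∑ k : Fin n, ∑ k' : Fin n,
      (if r = t ∧ k = k' then xop s k' * dop c k else 0))
      = if r = t then gEop m l n xop dop s c else 0 := by
    by_cases h : r = t <;> simp [h, gEop]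
  rw [← hs1, ← hs2]
  simp only [gEop, Finset.sum_mul_sum]
  rw [Finset.sum_comm (f := fun i j => xop s i * dop t i * (xop r j * dop c j))]
  simp only [← Finset.sum_sub_distrib, ← Finset.sum_add_distrib]
  exact Finset.sum_congr rfl fun k _ => Finset.sum_congr rfl fun k' _ => key k k'

theorem thirdMap_mul {V U G : Type*}
    [AddCommGroup V] [Module ℂ V] [AddCommGroup U] [Module ℂ U]
    [AddCommGroup G] [Module ℂ G] (f g : Module.End ℂ G) (x : V ⊗[ℂ] (U ⊗[ℂ] G)) :
    thirdMap (f * g) x = thirdMap f (thirdMap g x) := by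
  have : (thirdMap (f * g) : (V ⊗[ℂ] (U ⊗[ℂ] G)) →ₗ[ℂ] _) = thirdMap f ∘ₗ thirdMap g := by
    ext; simp [thirdMap]
  rw [this]; rfl

theorem thirdMap_add {V U G : Type*}
    [AddCommGroup V] [Module ℂ V] [AddCommGroup U] [Module ℂ U]
    [AddCommGroup G] [Module ℂ G] (f g : Module.End ℂ G) :
    (thirdMap (f + g) : (V ⊗[ℂ] (U ⊗[ℂ] G)) →ₗ[ℂ] _) = thirdMap f + thirdMap g := by
  ext; simp [thirdMap, TensorProduct.tmul_add]

theorem thirdMap_neg {V U G : Type*}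
    [AddCommGroup V] [Module ℂ V] [AddCommGroup U] [Module ℂ U]
    [AddCommGroup G] [Module ℂ G] (f : Module.End ℂ G) :
    (thirdMap (-f) : (V ⊗[ℂ] (U ⊗[ℂ] G)) →ₗ[ℂ] _) = -thirdMap f := by
  ext; simp [thirdMap, TensorProduct.tmul_neg]

theorem thirdMap_rhoV {V U G : Type*}
    [AddCommGroup V] [Module ℂ V] [AddCommGroup U] [Module ℂ U]
    [AddCommGroup G] [Module ℂ G] (f : Module.End ℂ G) (r : Module.End ℂ V)
    (x : V ⊗[ℂ] (U ⊗[ℂ] G)) :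
    TensorProduct.map r LinearMap.id (thirdMap f x)
      = thirdMap f (TensorProduct.map r LinearMap.id x) := by
  have : TensorProduct.map r LinearMap.id ∘ₗ (thirdMap f : (V ⊗[ℂ] (U ⊗[ℂ] G)) →ₗ[ℂ] _)
      = thirdMap f ∘ₗ TensorProduct.map r LinearMap.id := by
    ext; simp [thirdMap]
  exact LinearMap.congr_fun this x

theorem thirdMap_rhoU {V U G : Type*}
    [AddCommGroup V] [Module ℂ V] [AddCommGroup U] [Module ℂ U]
    [AddCommGroup G] [Module ℂ G] (f : Module.End ℂ G) (r : Module.End ℂ U)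
    (x : V ⊗[ℂ] (U ⊗[ℂ] G)) :
    TensorProduct.map LinearMap.id (TensorProduct.map r LinearMap.id) (thirdMap f x)
      = thirdMap f (TensorProduct.map LinearMap.id (TensorProduct.map r LinearMap.id) x) := by
  have : TensorProduct.map LinearMap.id (TensorProduct.map r LinearMap.id) ∘ₗ
        (thirdMap f : (V ⊗[ℂ] (U ⊗[ℂ] G)) →ₗ[ℂ] _)
      = thirdMap f ∘ₗ TensorProduct.map LinearMap.id (TensorProduct.map r LinearMap.id) := by
    ext; simp [thirdMap]
  exact LinearMap.congr_fun this x

theorem neg_comm_aux {M : Type*} [AddCommGroup M] [Module ℂ M]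
    (f g : Module.End ℂ M) (h : f * g = g * f) : (-f) * (-g) = (-g) * (-f) := by
  rw [neg_mul_neg, neg_mul_neg, h]

/-- Polynomial functional calculus for a commuting family of endomorphisms. -/
theorem exists_calculus {σ M : Type*} [AddCommGroup M] [Module ℂ M]
    (N : σ → Module.End ℂ M) (hN : ∀ p q, N p * N q = N q * N p) :
    ∃ Φ : MvPolynomial σ ℂ →ₐ[ℂ] Module.End ℂ M, ∀ p, Φ (MvPolynomial.X p) = N p := by
  let _ : CommRing (Algebra.adjoin ℂ (Set.range N)) :=
    { (inferInstance : Ring (Algebra.adjoin ℂ (Set.range N))) with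
      mul_comm := by
        have := Algebra.isMulCommutative_adjoin ℂ (s := Set.range N) (by
          rintro _ ⟨p, rfl⟩ _ ⟨q, rfl⟩; exact hN p q)
        exact fun a b => this.is_comm.comm a b }
  refine ⟨(Algebra.adjoin ℂ (Set.range N)).val.comp
    (MvPolynomial.aeval fun p => ⟨N p, Algebra.subset_adjoin ⟨p, rfl⟩⟩), fun p => ?_⟩
  simp

theorem qAct_tmul {V U G : Type*}
    [AddCommGroup V] [Module ℂ V] [AddCommGroup U] [Module ℂ U]
    [AddCommGroup G] [Module ℂ G] (m l n : ℕ)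
    (xop dop : Fin (m + l) → Fin n → Module.End ℂ G) (a : Fin m) (d : Fin l)
    (P : UQ m l) (x : V ⊗[ℂ] (U ⊗[ℂ] G)) :
    qAct m l n xop dop a d (P ⊗ₜ[ℂ] x) = (MvPolynomial.X (a, d) * P) ⊗ₜ[ℂ] x
      + P ⊗ₜ[ℂ] thirdMap (gEop m l n xop dop (Fin.natAdd m d) (Fin.castAdd l a)) x := by
  simp [qAct]

theorem qAct_mem {V U G : Type*}
    [AddCommGroup V] [Module ℂ V] [AddCommGroup U] [Module ℂ U]
    [AddCommGroup G] [Module ℂ G] (m l n : ℕ)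
    (xop dop : Fin (m + l) → Fin n → Module.End ℂ G) (a : Fin m) (d : Fin l)
    (w : Wmod m l V U G) : qAct m l n xop dop a d w ∈ qW m l n V U G xop dop :=
  Submodule.mem_iSup_of_mem (p := fun p : Fin m × Fin l =>
    LinearMap.range (qAct (V := V) (U := U) m l n xop dop p.1 p.2)) (a, d) ⟨w, rfl⟩

theorem natAdd_ne_castAdd {m l : ℕ} (d : Fin l) (a : Fin m) :
    Fin.natAdd m d ≠ Fin.castAdd l a := by
  intro h
  have := congrArg Fin.val h
  simp at this
  omega

/-- An operator that commutes with `q` up to `q` preserves `q·W`. -/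
theorem qW_stable {V U G : Type*}
    [AddCommGroup V] [Module ℂ V] [AddCommGroup U] [Module ℂ U]
    [AddCommGroup G] [Module ℂ G] (m l n : ℕ)
    (xop dop : Fin (m + l) → Fin n → Module.End ℂ G)
    (T : Wmod m l V U G →ₗ[ℂ] Wmod m l V U G)
    (h : ∀ (c : Fin m) (d : Fin l) (P : UQ m l) (x : V ⊗[ℂ] (U ⊗[ℂ] G)),
      T (qAct m l n xop dop c d (P ⊗ₜ[ℂ] x)) ∈ qW m l n V U G xop dop) :
    ∀ w ∈ qW m l n V U G xop dop, T w ∈ qW m l n V U G xop dop := by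
  suffices hle : qW m l n V U G xop dop ≤ (qW m l n V U G xop dop).comap T from
    fun w hw => hle hw
  refine iSup_le fun p => ?_
  rintro _ ⟨w, rfl⟩
  rw [Submodule.mem_comap]
  induction w using TensorProduct.induction_on with
  | zero => simp
  | add x y hx hy => rw [map_add, map_add]; exact add_mem hx hy
  | tmul P x => exact h p.1 p.2 P x

end Helpers

/-- key step in the proof of Theorem 2.1: the map
`χ : V ⊗ U ⊗ G → W/(q·W)`, `y ⊗ x ⊗ f ↦ [1 ⊗ y ⊗ x ⊗ f]`, is a linear
bijection onto the space of `q`-coinvariants of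
`W = (V ⊠ U) ⊗ G(ℂ^{m+l} ⊗ ℂ^n)`, and it intertwines the actions of
`gl_m ⊕ gl_l` (which preserve `q·W`, hence descend to the quotient).
Injectivity and surjectivity of the induced map to the quotient `W/(q·W)`
are expressed directly in terms of the submodule `q·W`, and likewise the
intertwining property is stated modulo `q·W`. -/
theorem parabolic_coinvariants_iso (m l n : ℕ)
    (ρV : Fin m → Fin m → Module.End ℂ V)
    (hρV : ∀ a b c d : Fin m,
      ρV a b * ρV c d - ρV c d * ρV a b
        = (if b = c then ρV a d else 0) - (if d = a then ρV c b else 0))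
    (ρU : Fin l → Fin l → Module.End ℂ U)
    (hρU : ∀ a b c d : Fin l,
      ρU a b * ρU c d - ρU c d * ρU a b
        = (if b = c then ρU a d else 0) - (if d = a then ρU c b else 0))
    (xop dop : Fin (m + l) → Fin n → Module.End ℂ G)
    (hxx : ∀ (r c : Fin (m + l)) (k k' : Fin n),
      xop r k * xop c k' = -(xop c k' * xop r k))
    (hdd : ∀ (r c : Fin (m + l)) (k k' : Fin n),
      dop r k * dop c k' = -(dop c k' * dop r k))
    (hxd : ∀ (r c : Fin (m + l)) (k k' : Fin n),
      xop r k * dop c k' + dop c k' * xop r k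
        = if r = c ∧ k = k' then 1 else 0) :
    -- the induced map `χ` to the coinvariants `W/(q·W)` is injective …
    (∀ x : V ⊗[ℂ] (U ⊗[ℂ] G),
      iota m l x ∈ qW m l n V U G xop dop → x = 0) ∧
    -- … and surjective
    (∀ w : Wmod m l V U G, ∃ x : V ⊗[ℂ] (U ⊗[ℂ] G),
      w - iota m l x ∈ qW m l n V U G xop dop) ∧
    -- `q·W` is stable under `gl_m ⊕ gl_l`, so the actions descend …
    (∀ a b : Fin m, ∀ w ∈ qW m l n V U G xop dop,
      glmW m l n ρV xop dop a b w ∈ qW m l n V U G xop dop) ∧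
    (∀ c d : Fin l, ∀ w ∈ qW m l n V U G xop dop,
      gllW m l n ρU xop dop c d w ∈ qW m l n V U G xop dop) ∧
    -- … and `χ` intertwines the `gl_m ⊕ gl_l`-actions (modulo `q·W`)
    (∀ (a b : Fin m) (x : V ⊗[ℂ] (U ⊗[ℂ] G)),
      glmW m l n ρV xop dop a b (iota m l x)
          - iota m l (glmVUG m l n ρV xop dop a b x)
        ∈ qW m l n V U G xop dop) ∧
    (∀ (c d : Fin l) (x : V ⊗[ℂ] (U ⊗[ℂ] G)),
      gllW m l n ρU xop dop c d (iota m l x)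
          - iota m l (gllVUG m l n ρU xop dop c d x)
        ∈ qW m l n V U G xop dop) := by
  have comm := gEop_comm m l n xop dop hxx hdd hxd
  refine ⟨?_, ?_, ?_, ?_, ?_, ?_⟩
  · intro x hx
    let N : Fin m × Fin l → Module.End ℂ (V ⊗[ℂ] (U ⊗[ℂ] G)) := fun p =>
      thirdMap (gEop m l n xop dop (Fin.natAdd m p.2) (Fin.castAdd l p.1))
    have hN : ∀ p q, N p * N q = N q * N p := by
      intro p q
      refine LinearMap.ext fun y => ?_
      simp only [N, Module.End.mul_apply]
      rw [← thirdMap_mul, ← thirdMap_mul, comm]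
      simp [natAdd_ne_castAdd]
    obtain ⟨Φ, hΦ⟩ := exists_calculus (fun p => -N p) (fun p q => neg_comm_aux _ _ (hN p q))
    let ev : Wmod m l V U G →ₗ[ℂ] V ⊗[ℂ] (U ⊗[ℂ] G) := TensorProduct.lift Φ.toLinearMap
    have hev : ∀ P y, ev (P ⊗ₜ[ℂ] y) = Φ P y := fun P y => by simp [ev]
    have hcomm : ∀ p (P : UQ m l) y, Φ (MvPolynomial.X p * P) y = - Φ P (N p y) := by
      intro p P y
      rw [mul_comm, map_mul, hΦ]
      simp
    have hle : qW m l n V U G xop dop ≤ LinearMap.ker ev := by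
      refine iSup_le fun p => ?_
      rintro _ ⟨w, rfl⟩
      rw [LinearMap.mem_ker]
      induction w using TensorProduct.induction_on with
      | zero => simp
      | add x y hx hy => rw [map_add, map_add, hx, hy, add_zero]
      | tmul P y =>
        rw [qAct_tmul, map_add, hev, hev, hcomm]
        exact neg_add_cancel _
    have h0 := hle hx
    rw [LinearMap.mem_ker, iota, TensorProduct.mk_apply, hev, map_one] at h0
    exact h0
  · intro w
    induction w using TensorProduct.induction_on with
    | zero => exact ⟨0, by simp⟩
    | add w₁ w₂ h₁ h₂ =>
      obtain ⟨x₁, h₁⟩ := h₁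
      obtain ⟨x₂, h₂⟩ := h₂
      refine ⟨x₁ + x₂, ?_⟩
      rw [map_add, add_sub_add_comm]
      exact add_mem h₁ h₂
    | tmul P x =>
      induction P using MvPolynomial.induction_on generalizing x with
      | C c =>
        refine ⟨c • x, ?_⟩
        have : (MvPolynomial.C c : UQ m l) = c • (1 : UQ m l) := by
          rw [MvPolynomial.smul_eq_C_mul, mul_one]
        rw [this, iota, TensorProduct.mk_apply, TensorProduct.smul_tmul, sub_self]
        exact zero_mem _
      | add P Q hP hQ =>
        obtain ⟨x₁, h₁⟩ := hP x
        obtain ⟨x₂, h₂⟩ := hQ x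
        refine ⟨x₁ + x₂, ?_⟩
        rw [map_add, TensorProduct.add_tmul, add_sub_add_comm]
        exact add_mem h₁ h₂
      | mul_X P p hP =>
        obtain ⟨y, hy⟩ := hP
          (thirdMap (gEop m l n xop dop (Fin.natAdd m p.2) (Fin.castAdd l p.1)) x)
        refine ⟨-y, ?_⟩
        have h1 := qAct_mem m l n xop dop p.1 p.2 (P ⊗ₜ[ℂ] x)
        rw [qAct_tmul] at h1
        have h2 := sub_mem h1 hy
        rw [map_neg, mul_comm]
        convert h2 using 1
        abel
  · intro a b
    refine qW_stable m l n xop dop _ fun c d P x => ?_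
    have : glmW m l n ρV xop dop a b (qAct m l n xop dop c d (P ⊗ₜ[ℂ] x))
        = qAct m l n xop dop c d (glmW m l n ρV xop dop a b (P ⊗ₜ[ℂ] x))
          - (if c = a then qAct m l n xop dop b d (P ⊗ₜ[ℂ] x) else 0) := by
      have hD : DmDer m l a b (MvPolynomial.X (c, d) * P)
          = MvPolynomial.X (c, d) * DmDer m l a b P
            - (if c = a then MvPolynomial.X (b, d) * P else 0) := by
        change MvPolynomial.mkDerivation ℂ (fun p : Fin m × Fin l => if p.1 = a then -(MvPolynomial.X (b, p.2) : UQ m l) else 0) _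
          = _ * MvPolynomial.mkDerivation ℂ (fun p : Fin m × Fin l => if p.1 = a then -(MvPolynomial.X (b, p.2) : UQ m l) else 0) _ - _
        simp only [Derivation.leibniz, MvPolynomial.mkDerivation_X, smul_eq_mul]
        split_ifs <;> ring
      have hE := comm (Fin.castAdd l a) (Fin.castAdd l b) (Fin.natAdd m d) (Fin.castAdd l c)
      rw [if_neg (natAdd_ne_castAdd d b)] at hE
      have hT : thirdMap (gEop m l n xop dop (Fin.castAdd l a) (Fin.castAdd l b))
            (thirdMap (gEop m l n xop dop (Fin.natAdd m d) (Fin.castAdd l c)) x)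
          = thirdMap (gEop m l n xop dop (Fin.natAdd m d) (Fin.castAdd l c))
            (thirdMap (gEop m l n xop dop (Fin.castAdd l a) (Fin.castAdd l b)) x)
            - (if c = a then
                thirdMap (gEop m l n xop dop (Fin.natAdd m d) (Fin.castAdd l b)) x else 0) := by
        rw [← thirdMap_mul, hE, thirdMap_add, ← thirdMap_mul, LinearMap.add_apply, zero_sub,
          thirdMap_neg, LinearMap.neg_apply, ← sub_eq_add_neg]
        by_cases h : c = a
        · simp [h]
        · have h' : ¬ a = c := fun e => h e.symm
          simp [h, h', thirdMap]
      simp only [qAct_tmul, glmW, map_add, LinearMap.add_apply, TensorProduct.map_tmul,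
        LinearMap.id_apply, hD, hT, thirdMap_rhoV]
      split_ifs <;> simp only [TensorProduct.sub_tmul, TensorProduct.tmul_sub, sub_zero] <;> abel
    rw [this]
    refine sub_mem (qAct_mem _ _ _ _ _ _ _ _) ?_
    split_ifs
    · exact qAct_mem _ _ _ _ _ _ _ _
    · exact zero_mem _
  · intro a b
    refine qW_stable m l n xop dop _ fun c d P x => ?_
    have : gllW m l n ρU xop dop a b (qAct m l n xop dop c d (P ⊗ₜ[ℂ] x))
        = qAct m l n xop dop c d (gllW m l n ρU xop dop a b (P ⊗ₜ[ℂ] x))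
          + (if d = b then qAct m l n xop dop c a (P ⊗ₜ[ℂ] x) else 0) := by
      have hD : DlDer m l a b (MvPolynomial.X (c, d) * P)
          = MvPolynomial.X (c, d) * DlDer m l a b P
            + (if d = b then MvPolynomial.X (c, a) * P else 0) := by
        change MvPolynomial.mkDerivation ℂ (fun p : Fin m × Fin l => if p.2 = b then (MvPolynomial.X (p.1, a) : UQ m l) else 0) _
          = _ * MvPolynomial.mkDerivation ℂ (fun p : Fin m × Fin l => if p.2 = b then (MvPolynomial.X (p.1, a) : UQ m l) else 0) _ + _
        simp only [Derivation.leibniz, MvPolynomial.mkDerivation_X, smul_eq_mul]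
        split_ifs <;> ring
      have hE := comm (Fin.natAdd m a) (Fin.natAdd m b) (Fin.natAdd m d) (Fin.castAdd l c)
      rw [if_neg (natAdd_ne_castAdd a c)] at hE
      have hT : thirdMap (gEop m l n xop dop (Fin.natAdd m a) (Fin.natAdd m b))
            (thirdMap (gEop m l n xop dop (Fin.natAdd m d) (Fin.castAdd l c)) x)
          = thirdMap (gEop m l n xop dop (Fin.natAdd m d) (Fin.castAdd l c))
            (thirdMap (gEop m l n xop dop (Fin.natAdd m a) (Fin.natAdd m b)) x)
            + (if d = b then
                thirdMap (gEop m l n xop dop (Fin.natAdd m a) (Fin.castAdd l c)) x else 0) := by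
        rw [← thirdMap_mul, hE, thirdMap_add, ← thirdMap_mul, LinearMap.add_apply, sub_zero]
        by_cases h : d = b
        · simp [h]
        · simp [h, thirdMap]
      simp only [qAct_tmul, gllW, map_add, LinearMap.add_apply, TensorProduct.map_tmul,
        LinearMap.id_apply, hD, hT, thirdMap_rhoU]
      split_ifs <;> simp only [TensorProduct.add_tmul, TensorProduct.tmul_add, add_zero] <;> abel
    rw [this]
    refine add_mem (qAct_mem _ _ _ _ _ _ _ _) ?_
    split_ifs
    · exact qAct_mem _ _ _ _ _ _ _ _
    · exact zero_mem _
  · intro a b x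
    have h1 : DmDer m l a b 1 = 0 := by simp [DmDer]
    have : glmW m l n ρV xop dop a b (iota m l x)
          - iota m l (glmVUG m l n ρV xop dop a b x) = 0 := by
      simp [glmW, glmVUG, iota, h1, TensorProduct.tmul_add]
    rw [this]
    exact zero_mem _
  · intro a b x
    have h1 : DlDer m l a b 1 = 0 := by simp [DlDer]
    have : gllW m l n ρU xop dop a b (iota m l x)
          - iota m l (gllVUG m l n ρU xop dop a b x) = 0 := by
      simp [gllW, gllVUG, iota, h1, TensorProduct.tmul_add]
    rw [this]
    exact zero_mem _
end
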